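/- Lemma 6.2: Suppose assumptions A1, A2, A3 hold and let (y_n, λ_n, s_n, γ_n) be the recursive construction of Theorem 6.1. Then there exist constants M1, M2, M3, independent of n, such that for all n ≥ 1: (a) ‖g_n‖ ≤ M1‖h_n‖; (b) ‖h_n‖ ≤ M2(‖y_{n−1}‖ + Σ_{i=2}^{n−1} ‖y_{n−i}‖·‖h_i‖); (c) ‖y_n‖_{H²} ≤ M3(‖h_n‖ + Σ_{i=2}^{n−1} ‖h_i‖·‖h_{n+1−i}‖). -/

import Mathlib

open MeasureTheory Set Filter

noncomputable section

/-- `Sol1D d lam g y y'` : C¹ solution on `[0,∞)` of `-y'' + d y - lam y = g`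
(away from finitely many points) with `y'(0) = 0`. -/
def Sol1D (d : ℝ → ℝ) (lam : ℝ) (g : ℝ → ℝ) (y y' : ℝ → ℝ) : Prop :=
  (∀ x ∈ Set.Ici (0 : ℝ), HasDerivWithinAt y (y' x) (Set.Ici 0) x) ∧
  ContinuousOn y' (Set.Ici 0) ∧
  (∃ E : Finset ℝ, ∀ x ∈ Set.Ioi (0 : ℝ), x ∉ (E : Set ℝ) →
    HasDerivAt y' (d x * y x - lam * y x - g x) x) ∧
  y' 0 = 0

/-- A bound state of `-d²/dx² + d(x)` on `(0,∞)` with Neumann condition at `0`. -/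
def IsBoundState1D (d : ℝ → ℝ) (lam : ℝ) (y y' : ℝ → ℝ) : Prop :=
  Sol1D d lam (fun _ => 0) y y' ∧
  Filter.Tendsto y Filter.atTop (nhds 0) ∧
  ∃ x ∈ Set.Ici (0 : ℝ), y x ≠ 0

/-- Solution of the uncoupled inhomogeneous system
`-y'' + diag(D) y - lam y = g` with `y'(0) = 0` and decay at `+∞`. -/
def DiagBVPSol (D : ℝ → Fin 3 → ℝ) (lam : ℝ) (g : ℝ → Fin 3 → ℝ)
    (y y' : ℝ → Fin 3 → ℝ) : Prop :=
  (∀ x ∈ Set.Ici (0 : ℝ), HasDerivWithinAt y (y' x) (Set.Ici 0) x) ∧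
  ContinuousOn y' (Set.Ici 0) ∧
  (∃ E : Finset ℝ, ∀ x ∈ Set.Ioi (0 : ℝ), x ∉ (E : Set ℝ) →
    HasDerivAt y' (fun i => D x i * y x i - lam * y x i - g x i) x) ∧
  y' 0 = 0 ∧
  Filter.Tendsto y Filter.atTop (nhds 0)

/-- The right hand side `g_n = Σ_{k=1}^n (λ_k - s_k D1) y_{n-k} - F y_{n-1}`. -/
def Gseq (D1 : ℝ → Fin 3 → ℝ) (F : ℝ → Fin 3 → Fin 3 → ℝ)
    (lamseq sseq : ℕ → ℝ) (Y : ℕ → ℝ → Fin 3 → ℝ) (n : ℕ) : ℝ → Fin 3 → ℝ :=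
  fun x i =>
    (∑ k ∈ Finset.Icc 1 n, (lamseq k - sseq k * D1 x i) * Y (n - k) x i) -
    ∑ j, F x i j * Y (n - 1) x j

/-- `h_n = F y_{n-1} + Σ_{k=1}^{n-1} (s_k D1 - λ_k) y_{n-k}`. -/
def Hseq (D1 : ℝ → Fin 3 → ℝ) (F : ℝ → Fin 3 → Fin 3 → ℝ)
    (lamseq sseq : ℕ → ℝ) (Y : ℕ → ℝ → Fin 3 → ℝ) (n : ℕ) : ℝ → Fin 3 → ℝ :=
  fun x i =>
    (∑ j, F x i j * Y (n - 1) x j) +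
    ∑ k ∈ Finset.Icc 1 (n - 1), (sseq k * D1 x i - lamseq k) * Y (n - k) x i

/-- The L² norm of a real vector function on `(0,∞)`. -/
def vecL2 (f : ℝ → Fin 3 → ℝ) : ℝ :=
  Real.sqrt (∫ x in Set.Ioi (0 : ℝ), ∑ i, (f x i) ^ 2)

/-- The H² norm of a real vector function on `(0,∞)`. -/
def vecH2 (f f' : ℝ → Fin 3 → ℝ) : ℝ :=
  Real.sqrt ((∫ x in Set.Ioi (0 : ℝ), ∑ i, (f x i) ^ 2) +
    (∫ x in Set.Ioi (0 : ℝ), ∑ i, (f' x i) ^ 2) +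
    (∫ x in Set.Ioi (0 : ℝ), ∑ i, (deriv (fun t => f' t i) x) ^ 2))

/-- A Grönwall estimate, in both directions, for functions differentiable off a finite set. -/
theorem gronwall_off_finite {u u' w : ℝ → ℝ} {a b c : ℝ} (hab : a ≤ b) (hc : 0 ≤ c)
    (E : Finset ℝ) (hu : ContinuousOn u (Icc a b))
    (hu' : ∀ x ∈ Ioo a b, x ∉ (E : Set ℝ) → HasDerivAt u (u' x) x)
    (hi : IntervalIntegrable u' volume a b) (hw : IntervalIntegrable w volume a b)
    (hw0 : ∀ x, 0 ≤ w x) (hle : ∀ x ∈ Ioo a b, |u' x| ≤ c * u x + w x) :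
    u b ≤ Real.exp (c * (b - a)) * (u a + ∫ x in a..b, w x) ∧
    u a ≤ Real.exp (c * (b - a)) * (u b + ∫ x in a..b, w x) := by
  have hui : IntervalIntegrable u volume a b := by
    apply ContinuousOn.intervalIntegrable
    rwa [uIcc_of_le hab]
  have hexp : Real.exp (c * (b - a)) * Real.exp (-(c * (b - a))) = 1 := by
    rw [← Real.exp_add]; simp
  have hpos := Real.exp_pos (c * (b - a))
  constructor
  · have hi' : IntervalIntegrable (fun x => Real.exp (-(c * (x - a))) * (u' x - c * u x))
        volume a b := (hi.sub (hui.const_mul c)).continuousOn_mul (by fun_prop)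
    have key := integral_eq_of_hasDerivAt_off_countable_of_le
      (fun x => Real.exp (-(c * (x - a))) * u x)
      (fun x => Real.exp (-(c * (x - a))) * (u' x - c * u x)) hab E.countable_toSet
      (ContinuousOn.mul (by fun_prop) hu) (by
        intro x hx
        have h1 : HasDerivAt (fun x => Real.exp (-(c * (x - a))))
            (Real.exp (-(c * (x - a))) * (-c)) x := by
          have := ((((hasDerivAt_id x).sub_const a).const_mul c).neg).exp
          simpa using this
        exact (h1.mul (hu' x hx.1 hx.2)).congr_deriv (by ring)) hi'
    have hmono := intervalIntegral.integral_mono_on_of_le_Ioo hab hi' hw (by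
      intro x hx
      have h1 : Real.exp (-(c * (x - a))) ≤ 1 :=
        Real.exp_le_one_iff.2 (by nlinarith [hx.1, mul_nonneg hc (sub_nonneg.2 hx.1.le)])
      have h2 := (abs_le.1 (hle x hx)).2
      have h3 := Real.exp_pos (-(c * (x - a)))
      nlinarith [hw0 x, mul_le_mul_of_nonneg_left (show u' x - c * u x ≤ w x by linarith) h3.le])
    rw [key] at hmono
    simp only [sub_self, mul_zero, neg_zero, Real.exp_zero, one_mul] at hmono
    calc u b = Real.exp (c * (b - a)) * (Real.exp (-(c * (b - a))) * u b) := by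
          rw [← mul_assoc, hexp, one_mul]
      _ ≤ _ := by gcongr; linarith
  · have hi' : IntervalIntegrable (fun x => Real.exp (-(c * (b - x))) * (u' x + c * u x))
        volume a b := (hi.add (hui.const_mul c)).continuousOn_mul (by fun_prop)
    have key := integral_eq_of_hasDerivAt_off_countable_of_le
      (fun x => Real.exp (-(c * (b - x))) * u x)
      (fun x => Real.exp (-(c * (b - x))) * (u' x + c * u x)) hab E.countable_toSet
      (ContinuousOn.mul (by fun_prop) hu) (by
        intro x hx
        have h1 : HasDerivAt (fun x => Real.exp (-(c * (b - x))))
            (Real.exp (-(c * (b - x))) * c) x := by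
          have := ((((hasDerivAt_id x).const_sub b).const_mul c).neg).exp
          simpa using this
        exact (h1.mul (hu' x hx.1 hx.2)).congr_deriv (by ring)) hi'
    have hmono := intervalIntegral.integral_mono_on_of_le_Ioo hab hw.neg hi' (by
      intro x hx
      have h1 : Real.exp (-(c * (b - x))) ≤ 1 :=
        Real.exp_le_one_iff.2 (by nlinarith [hx.1, mul_nonneg hc (sub_nonneg.2 hx.2.le)])
      have h2 := (abs_le.1 (hle x hx)).1
      have h3 := Real.exp_pos (-(c * (b - x)))
      simp only [Pi.neg_apply]
      nlinarith [hw0 x, mul_le_mul_of_nonneg_left (show -w x ≤ u' x + c * u x by linarith) h3.le])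
    rw [key] at hmono
    simp only [sub_self, mul_zero, neg_zero, Real.exp_zero, one_mul, Pi.neg_apply,
      intervalIntegral.integral_neg] at hmono
    calc u a = Real.exp (c * (b - a)) * (Real.exp (-(c * (b - a))) * u a) := by
          rw [← mul_assoc, hexp, one_mul]
      _ ≤ _ := by gcongr; linarith

/-- A function which is square integrable on `(0,∞)` is integrable on bounded intervals. -/
theorem MemLp.intervalIntegrable_of_nonneg {g : ℝ → ℝ}
    (hg : MemLp g 2 (volume.restrict (Ioi 0))) {a b : ℝ} (ha : 0 ≤ a) (hab : a ≤ b) :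
    IntervalIntegrable g volume a b := by
  rw [intervalIntegrable_iff_integrableOn_Ioc_of_le hab]
  have h1 : MemLp g 2 (volume.restrict (Ioc a b)) :=
    hg.mono_measure (Measure.restrict_mono (fun x hx => ha.trans_lt hx.1) le_rfl)
  exact h1.integrable (by norm_num)

theorem intervalIntegral_le_integral_Ioi {w : ℝ → ℝ} (hw : IntegrableOn w (Ioi 0))
    (hw0 : ∀ x, 0 ≤ w x) {a b : ℝ} (ha : 0 ≤ a) (hab : a ≤ b) :
    ∫ x in a..b, w x ≤ ∫ x in Ioi (0 : ℝ), w x := by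
  rw [intervalIntegral.integral_of_le hab]
  exact setIntegral_mono_set hw (Eventually.of_forall hw0)
    (Eventually.of_forall fun x hx => ha.trans_lt hx.1)

theorem intervalIntegrable_of_Ioi {w : ℝ → ℝ} (hw : IntegrableOn w (Ioi 0))
    {a b : ℝ} (ha : 0 ≤ a) (hab : a ≤ b) : IntervalIntegrable w volume a b := by
  rw [intervalIntegrable_iff_integrableOn_Ioc_of_le hab]
  exact hw.mono_set fun x hx => ha.trans_lt hx.1

theorem intervalIntegrable_of_bounded {d : ℝ → ℝ} (hd : AEStronglyMeasurable d volume) {K : ℝ}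
    (hK : ∀ x, |d x| ≤ K) (a b : ℝ) : IntervalIntegrable d volume a b := by
  refine IntervalIntegrable.mono_fun (intervalIntegrable_const (c := K)) hd.restrict ?_
  exact Eventually.of_forall fun x => by
    simpa using (hK x).trans (le_abs_self K)

section Scalar

variable {d g y y' : ℝ → ℝ} {lam K L : ℝ}

theorem Sol1D.continuousOn (h : Sol1D d lam g y y') : ContinuousOn y (Ici 0) :=
  fun x hx => (h.1 x hx).continuousWithinAt

theorem Sol1D.hasDerivAt (h : Sol1D d lam g y y') {x : ℝ} (hx : 0 < x) :
    HasDerivAt y (y' x) x :=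
  (h.1 x hx.le).hasDerivAt (Ici_mem_nhds hx)

theorem Sol1D.intervalIntegrable_potential (h : Sol1D d lam g y y')
    (hd : AEStronglyMeasurable d volume) (hK : ∀ x, |d x - lam| ≤ K)
    (hg : MemLp g 2 (volume.restrict (Ioi 0))) {a b : ℝ} (ha : 0 ≤ a) (hab : a ≤ b) :
    IntervalIntegrable (fun x => d x * y x - lam * y x - g x) volume a b := by
  have hsub : uIcc a b ⊆ Ici 0 := by
    rw [uIcc_of_le hab]; exact fun x hx => ha.trans hx.1
  have h1 : IntervalIntegrable (fun x => (d x - lam) * y x) volume a b :=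
    (intervalIntegrable_of_bounded (hd.sub aestronglyMeasurable_const) hK a b).mul_continuousOn
      (h.continuousOn.mono hsub)
  convert h1.sub (MemLp.intervalIntegrable_of_nonneg hg ha hab) using 2
  ring

theorem Sol1D.sq_add_sq_le (h : Sol1D d lam g y y')
    (hd : AEStronglyMeasurable d volume) (hK : ∀ x, |d x - lam| ≤ K)
    (hg : MemLp g 2 (volume.restrict (Ioi 0))) {a b : ℝ} (ha : 0 ≤ a) (hab : a ≤ b) :
    y b ^ 2 + y' b ^ 2 ≤ Real.exp ((2 + K) * (b - a)) *
        (y a ^ 2 + y' a ^ 2 + ∫ x in Ioi (0 : ℝ), g x ^ 2) ∧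
    y a ^ 2 + y' a ^ 2 ≤ Real.exp ((2 + K) * (b - a)) *
        (y b ^ 2 + y' b ^ 2 + ∫ x in Ioi (0 : ℝ), g x ^ 2) := by
  have hK0 : 0 ≤ K := (abs_nonneg _).trans (hK 0)
  have hsub : Icc a b ⊆ Ici 0 := fun x hx => ha.trans hx.1
  have hsub' : uIcc a b ⊆ Ici 0 := by rwa [uIcc_of_le hab]
  have hy := h.continuousOn
  obtain ⟨-, hy', ⟨E, hE⟩, -⟩ := id h
  have hg2 : IntegrableOn (fun x => g x ^ 2) (Ioi 0) := hg.integrable_sq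
  have hint := h.intervalIntegrable_potential hd hK hg ha hab
  have hyi : IntervalIntegrable y volume a b := (hy.mono hsub').intervalIntegrable
  have := gronwall_off_finite (u := fun x => y x ^ 2 + y' x ^ 2)
    (u' := fun x => y x * (2 * y' x) + (d x * y x - lam * y x - g x) * (2 * y' x))
    (w := fun x => g x ^ 2) (c := 2 + K) hab (by linarith) E
    (((hy.mono hsub).pow 2).add ((hy'.mono hsub).pow 2))
    (by
      intro x hx hxE
      have hx0 : 0 < x := ha.trans_lt hx.1
      exact (((h.hasDerivAt hx0).pow 2).add ((hE x hx0 hxE).pow 2)).congr_deriv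
        (by push_cast; ring))
    ((hyi.mul_continuousOn (continuousOn_const.mul (hy'.mono hsub'))).add
      (hint.mul_continuousOn (continuousOn_const.mul (hy'.mono hsub'))))
    (intervalIntegrable_of_Ioi hg2 ha hab) (fun x => sq_nonneg _)
    (by
      intro x hx
      have h1 : |(d x - lam) * (2 * (y x * y' x))| ≤ K * (y x ^ 2 + y' x ^ 2) := by
        rw [abs_mul]
        refine mul_le_mul (hK x) ?_ (abs_nonneg _) hK0
        rw [abs_le]; constructor <;> nlinarith [sq_nonneg (y x + y' x), sq_nonneg (y x - y' x)]
      rw [abs_le] at h1 ⊢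
      constructor <;> nlinarith [sq_nonneg (y x + y' x), sq_nonneg (y x - y' x),
        sq_nonneg (g x + y' x), sq_nonneg (g x - y' x), h1.1, h1.2])
  have hI := intervalIntegral_le_integral_Ioi hg2 (fun x => sq_nonneg _) ha hab
  have hp := Real.exp_pos ((2 + K) * (b - a))
  exact ⟨this.1.trans (by gcongr), this.2.trans (by gcongr)⟩

theorem Sol1D.exists_mul_deriv_nonpos (h : Sol1D d lam g y y')
    (h0 : Tendsto y atTop (nhds 0)) (X : ℝ) : ∃ Z ≥ X, 0 ≤ Z ∧ y Z * y' Z ≤ 0 := by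
  by_contra! hcon
  set X' := max X 1 with hX'
  have hmono : MonotoneOn (fun x => y x ^ 2) (Ici X') := by
    apply monotoneOn_of_deriv_nonneg (convex_Ici _)
    · exact (h.continuousOn.mono fun x hx =>
        zero_le_one.trans ((le_max_right X 1).trans hx)).pow 2
    · intro x hx
      rw [interior_Ici] at hx
      have hx0 : 0 < x := zero_lt_one.trans_le ((le_max_right X 1).trans hx.le)
      exact ((h.hasDerivAt hx0).pow 2).differentiableAt.differentiableWithinAt
    · intro x hx
      rw [interior_Ici] at hx
      have hx0 : 0 < x := zero_lt_one.trans_le ((le_max_right X 1).trans hx.le)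
      have h1 := ((h.hasDerivAt hx0).pow 2).deriv
      have h2 := hcon x ((le_max_left X 1).trans hx.le) hx0.le
      change 0 ≤ deriv (y ^ 2) x
      rw [h1]; push_cast; nlinarith
  have hlim : Tendsto (fun x => y x ^ 2) atTop (nhds 0) := by simpa using h0.pow 2
  have hle : y X' ^ 2 ≤ 0 := ge_of_tendsto hlim (by
    filter_upwards [eventually_ge_atTop X'] with x hx
    exact hmono (mem_Ici.2 le_rfl) hx hx)
  have hz : y X' = 0 := by nlinarith [sq_nonneg (y X')]
  have := hcon X' (le_max_left _ _) (zero_le_one.trans (le_max_right _ _))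
  simp [hz] at this

/-- The energy identity bounds every nonnegative density dominated by the energy density. -/
theorem Sol1D.energy_bound (h : Sol1D d lam g y y')
    (h0 : Tendsto y atTop (nhds 0))
    (hd : AEStronglyMeasurable d volume) (hK : ∀ x, |d x - lam| ≤ K)
    (hg : MemLp g 2 (volume.restrict (Ioi 0))) {p w : ℝ → ℝ}
    (hp : ContinuousOn p (Ici 0)) (hp0 : ∀ x, 0 ≤ p x)
    (hw : IntegrableOn w (Ioi 0)) (hw0 : ∀ x, 0 ≤ w x)
    (hle : ∀ x > 0, p x ≤ y' x ^ 2 + ((d x - lam) * y x ^ 2 - g x * y x) + w x) :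
    IntegrableOn p (Ioi 0) ∧ ∫ x in Ioi (0 : ℝ), p x ≤ ∫ x in Ioi (0 : ℝ), w x := by
  have hy := h.continuousOn
  obtain ⟨-, hy', ⟨E, hE⟩, hN⟩ := id h
  have hpi : ∀ X, 0 ≤ X → IntervalIntegrable p volume 0 X := fun X hX =>
    (hp.mono (by rw [uIcc_of_le hX]; exact fun x hx => hx.1)).intervalIntegrable
  have hbound : ∀ X, 0 ≤ X → ∫ x in (0 : ℝ)..X, p x ≤ ∫ x in Ioi (0 : ℝ), w x := by
    intro X hX
    obtain ⟨Z, hZX, hZ, hZn⟩ := h.exists_mul_deriv_nonpos h0 X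
    have hsub : uIcc 0 Z ⊆ Ici 0 := by rw [uIcc_of_le hZ]; exact fun x hx => hx.1
    have hint := h.intervalIntegrable_potential hd hK hg le_rfl hZ
    have hi' : IntervalIntegrable
        (fun x => y' x * y' x + (d x * y x - lam * y x - g x) * y x) volume 0 Z :=
      (((hy'.mono hsub).mul (hy'.mono hsub)).intervalIntegrable).add
        (hint.mul_continuousOn (hy.mono hsub))
    have key := integral_eq_of_hasDerivAt_off_countable_of_le (fun x => y x * y' x)
      (fun x => y' x * y' x + (d x * y x - lam * y x - g x) * y x) hZ E.countable_toSet
      ((hy.mono fun x hx => hx.1).mul (hy'.mono fun x hx => hx.1)) (by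
        intro x hx
        exact ((h.hasDerivAt hx.1.1).mul (hE x hx.1.1 hx.2)).congr_deriv (by ring)) hi'
    have hwi := intervalIntegrable_of_Ioi hw le_rfl hZ
    have hmono := intervalIntegral.integral_mono_on_of_le_Ioo hZ (hpi Z hZ) (hi'.add hwi)
      (fun x hx => by
        have := hle x hx.1
        nlinarith)
    rw [intervalIntegral.integral_add hi' hwi, key, hN] at hmono
    have hI := intervalIntegral_le_integral_Ioi hw hw0 le_rfl hZ
    have hXZ : ∫ x in (0 : ℝ)..X, p x ≤ ∫ x in (0 : ℝ)..Z, p x :=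
      intervalIntegral.integral_mono_interval le_rfl hX hZX
        (Eventually.of_forall hp0) (hpi Z hZ)
    linarith
  have hpint : IntegrableOn p (Ioi 0) := by
    refine integrableOn_Ioi_of_intervalIntegral_norm_bounded (l := atTop) (b := fun X => max X 0)
      (∫ x in Ioi (0 : ℝ), w x) 0
      (fun X => (intervalIntegrable_iff_integrableOn_Ioc_of_le (le_max_right _ _)).1
        (hpi _ (le_max_right _ _)))
      (tendsto_atTop_mono (fun X => le_max_left X 0) tendsto_id) ?_
    refine Eventually.of_forall fun X => ?_
    simp only [Real.norm_eq_abs, abs_of_nonneg (hp0 _)]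
    exact hbound _ (le_max_right _ _)
  refine ⟨hpint, le_of_tendsto (intervalIntegral_tendsto_integral_Ioi 0 hpint tendsto_id) ?_⟩
  filter_upwards [eventually_ge_atTop 0] with X hX using hbound X hX

end Scalar
section Estimates

variable {d g y y' φ φ' : ℝ → ℝ} {lam K L m : ℝ}

theorem aestronglyMeasurable_of_continuousOn_Ici {f : ℝ → ℝ} (hf : ContinuousOn f (Ici 0)) :
    AEStronglyMeasurable f (volume.restrict (Ioi 0)) :=
  (hf.mono Ioi_subset_Ici_self).aestronglyMeasurable measurableSet_Ioi

theorem Sol1D.integral_deriv_sq_le (h : Sol1D d lam g y y')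
    (h0 : Tendsto y atTop (nhds 0))
    (hd : AEStronglyMeasurable d volume) (hK : ∀ x, |d x - lam| ≤ K)
    (hg : MemLp g 2 (volume.restrict (Ioi 0))) (hy : MemLp y 2 (volume.restrict (Ioi 0))) :
    MemLp y' 2 (volume.restrict (Ioi 0)) ∧ ∫ x in Ioi (0 : ℝ), y' x ^ 2 ≤
      (1 / 2) * (∫ x in Ioi (0 : ℝ), g x ^ 2) + (1 / 2 + K) * ∫ x in Ioi (0 : ℝ), y x ^ 2 := by
  have hK0 : 0 ≤ K := (abs_nonneg _).trans (hK 0)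
  have h1 : IntegrableOn (fun x => (1 / 2) * g x ^ 2) (Ioi 0) := hg.integrable_sq.const_mul _
  have h2 : IntegrableOn (fun x => (1 / 2 + K) * y x ^ 2) (Ioi 0) := hy.integrable_sq.const_mul _
  have hy' := h.2.1
  obtain ⟨hi, hle⟩ := h.energy_bound h0 hd hK hg (p := fun x => y' x ^ 2)
    (w := fun x => (1 / 2) * g x ^ 2 + (1 / 2 + K) * y x ^ 2) (hy'.pow 2)
    (fun x => sq_nonneg _) (h1.add h2) (fun x => by positivity)
    (fun x _ => by
      have := (abs_le.1 (hK x)).1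
      nlinarith [sq_nonneg (g x - y x), mul_nonneg (sub_nonneg.2 this) (sq_nonneg (y x))])
  refine ⟨(memLp_two_iff_integrable_sq (aestronglyMeasurable_of_continuousOn_Ici hy')).2 hi, ?_⟩
  rw [integral_add h1 h2, integral_const_mul, integral_const_mul] at hle
  exact hle

theorem Sol1D.integral_sq_le_of_bounded (h : Sol1D d lam g y y')
    (h0 : Tendsto y atTop (nhds 0))
    (hd : AEStronglyMeasurable d volume) (hK : ∀ x, |d x - lam| ≤ K)
    (hg : MemLp g 2 (volume.restrict (Ioi 0))) (hL : 0 ≤ L) (hm : 0 < m)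
    (hdL : ∀ x ≥ L, d x - lam = m) {B : ℝ} (hB : ∀ x ∈ Icc 0 L, y x ^ 2 ≤ B) :
    MemLp y 2 (volume.restrict (Ioi 0)) ∧ (m / 2) * ∫ x in Ioi (0 : ℝ), y x ^ 2 ≤
      (1 / (2 * m)) * (∫ x in Ioi (0 : ℝ), g x ^ 2) + L * ((K + m) * B) := by
  have hK0 : 0 ≤ K := (abs_nonneg _).trans (hK 0)
  have hB0 : 0 ≤ B := (sq_nonneg _).trans (hB 0 (by simpa using hL))
  have h1 : IntegrableOn (fun x => (1 / (2 * m)) * g x ^ 2) (Ioi 0) :=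
    hg.integrable_sq.const_mul _
  have h2 : IntegrableOn ((Ioc 0 L).indicator fun _ => (K + m) * B) (Ioi 0) :=
    ((integrableOn_const (by simp)).integrable_indicator measurableSet_Ioc).integrableOn
  obtain ⟨hi, hle⟩ := h.energy_bound h0 hd hK hg (p := fun x => (m / 2) * y x ^ 2)
    (w := fun x => (1 / (2 * m)) * g x ^ 2 + (Ioc 0 L).indicator (fun _ => (K + m) * B) x)
    (continuousOn_const.mul (h.continuousOn.pow 2))
    (fun x => by positivity) (h1.add h2)
    (fun x => add_nonneg (by positivity) (indicator_nonneg (fun _ _ => by positivity) _))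
    (fun x hx => by
      have hyoung : g x * y x ≤ 1 / (2 * m) * g x ^ 2 + m / 2 * y x ^ 2 := by
        have : 1 / (2 * m) * g x ^ 2 + m / 2 * y x ^ 2 - g x * y x
            = (g x - m * y x) ^ 2 / (2 * m) := by field_simp; ring
        have h3 : 0 ≤ (g x - m * y x) ^ 2 / (2 * m) := by positivity
        linarith
      by_cases hxL : x ≤ L
      · rw [indicator_of_mem (show x ∈ Ioc 0 L from ⟨hx, hxL⟩)]
        have hb := hB x ⟨le_of_lt hx, hxL⟩
        have h4 := (abs_le.1 (hK x)).1
        nlinarith [sq_nonneg (y' x), mul_nonneg (sub_nonneg.2 h4) (sq_nonneg (y x)),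
          mul_le_mul_of_nonneg_left hb (show 0 ≤ K + m by linarith)]
      · rw [indicator_of_notMem (fun hmem => hxL hmem.2), hdL x (not_le.1 hxL).le]
        nlinarith [sq_nonneg (y' x)])
  have hi' : IntegrableOn (fun x => y x ^ 2) (Ioi 0) := by
    have := Integrable.const_mul hi (2 / m)
    refine this.congr (Eventually.of_forall fun x => ?_)
    simp only
    field_simp
  refine ⟨(memLp_two_iff_integrable_sq
    (aestronglyMeasurable_of_continuousOn_Ici h.continuousOn)).2 hi', ?_⟩
  rw [integral_add h1 h2, integral_const_mul, integral_const_mul,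
    setIntegral_indicator measurableSet_Ioc,
    inter_eq_self_of_subset_right Ioc_subset_Ioi_self, setIntegral_const] at hle
  simpa [hL] using hle

theorem Sol1D.eq_zero_of_initial (h : Sol1D d lam (fun _ => 0) φ φ')
    (hd : AEStronglyMeasurable d volume) (hK : ∀ x, |d x - lam| ≤ K) (h0 : φ 0 = 0)
    {x : ℝ} (hx : 0 ≤ x) : φ x = 0 := by
  have h1 := (h.sq_add_sq_le hd hK (by simp) le_rfl hx).1
  have hN := h.2.2.2
  simp [h0, hN] at h1
  nlinarith [sq_nonneg (φ x), sq_nonneg (φ' x)]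

theorem Sol1D.sub_const_mul (h : Sol1D d lam g y y') (hφ : Sol1D d lam (fun _ => 0) φ φ')
    (a : ℝ) : Sol1D d lam g (fun x => y x - a * φ x) (fun x => y' x - a * φ' x) := by
  obtain ⟨h1, h2, ⟨E, hE⟩, h4⟩ := h
  obtain ⟨k1, k2, ⟨E', hE'⟩, k4⟩ := hφ
  refine ⟨fun x hx => (h1 x hx).sub ((k1 x hx).const_mul a),
    h2.sub (continuousOn_const.mul k2), ⟨E ∪ E', fun x hx hxE => ?_⟩, by simp [h4, k4]⟩
  rw [Finset.coe_union, mem_union, not_or] at hxE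
  exact ((hE x hx hxE.1).sub ((hE' x hx hxE.2).const_mul a)).congr_deriv (by ring)

theorem IsBoundState1D.memLp (hφ : IsBoundState1D d lam φ φ')
    (hd : AEStronglyMeasurable d volume) (hK : ∀ x, |d x - lam| ≤ K) (hL : 0 ≤ L) (hm : 0 < m)
    (hdL : ∀ x ≥ L, d x - lam = m) : MemLp φ 2 (volume.restrict (Ioi 0)) := by
  obtain ⟨B, hB⟩ := (isCompact_Icc (a := (0 : ℝ)) (b := L)).exists_bound_of_continuousOn
    (((hφ.1.continuousOn).mono fun x hx => hx.1).pow 2)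
  exact (hφ.1.integral_sq_le_of_bounded hφ.2.1 hd hK (by simp) hL hm hdL
    (fun x hx => (le_abs_self _).trans (hB x hx))).1

/-- The `L²` estimate for decaying solutions orthogonal to the bound state. -/
theorem IsBoundState1D.exists_integral_sq_le (hφ : IsBoundState1D d lam φ φ')
    (hφ1 : ∫ x in Ioi (0 : ℝ), φ x ^ 2 = 1)
    (hd : AEStronglyMeasurable d volume) (hK : ∀ x, |d x - lam| ≤ K) (hL : 0 ≤ L) (hm : 0 < m)
    (hdL : ∀ x ≥ L, d x - lam = m) :
    ∃ C : ℝ, 0 ≤ C ∧ ∀ g y y', Sol1D d lam g y y' → Tendsto y atTop (nhds 0) →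
      MemLp g 2 (volume.restrict (Ioi 0)) → ∫ x in Ioi (0 : ℝ), φ x * y x = 0 →
      MemLp y 2 (volume.restrict (Ioi 0)) ∧
        ∫ x in Ioi (0 : ℝ), y x ^ 2 ≤ C * ∫ x in Ioi (0 : ℝ), g x ^ 2 := by
  have hK0 : 0 ≤ K := (abs_nonneg _).trans (hK 0)
  have hφL := hφ.memLp hd hK hL hm hdL
  have hφ0 : φ 0 ≠ 0 := by
    intro h0
    obtain ⟨x, hx, hne⟩ := hφ.2.2
    exact hne (hφ.1.eq_zero_of_initial hd hK h0 hx)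
  refine ⟨2 / m * (1 / (2 * m) + L * ((K + m) * Real.exp ((2 + K) * L))), by positivity, ?_⟩
  intro g y y' hy hy0 hg horth
  set a := y 0 / φ 0 with ha
  have hz := hy.sub_const_mul hφ.1 a
  have hz0 : y 0 - a * φ 0 = 0 := by rw [ha]; field_simp; ring
  have hztend : Tendsto (fun x => y x - a * φ x) atTop (nhds 0) := by
    simpa using hy0.sub (hφ.2.1.const_mul a)
  have hG0 : 0 ≤ ∫ x in Ioi (0 : ℝ), g x ^ 2 := integral_nonneg fun x => sq_nonneg _
  obtain ⟨hzL, hzle⟩ := hz.integral_sq_le_of_bounded hztend hd hK hg hL hm hdL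
    (B := Real.exp ((2 + K) * L) * ∫ x in Ioi (0 : ℝ), g x ^ 2) (fun x hx => by
      have h1 := (hz.sq_add_sq_le hd hK hg le_rfl hx.1).1
      have hz0' := hz.2.2.2
      simp only [hz0, hz0', sub_zero, ne_eq, OfNat.ofNat_ne_zero, not_false_eq_true, zero_pow,
        zero_add] at h1
      have h2 : Real.exp ((2 + K) * x) ≤ Real.exp ((2 + K) * L) :=
        Real.exp_le_exp.2 (mul_le_mul_of_nonneg_left hx.2 (by linarith))
      nlinarith [sq_nonneg (y' x - a * φ' x), mul_le_mul_of_nonneg_right h2 hG0])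
  have hyL : MemLp y 2 (volume.restrict (Ioi 0)) := by
    convert hzL.add (hφL.const_mul a) using 1
    ext x; simp
  refine ⟨hyL, ?_⟩
  have hexpand : ∫ x in Ioi (0 : ℝ), (y x - a * φ x) ^ 2
      = (∫ x in Ioi (0 : ℝ), y x ^ 2) + a ^ 2 := by
    have hi1 := hyL.integrable_sq
    have hi2 := hφL.integrable_sq
    have hi3 : Integrable (fun x => φ x * y x) (volume.restrict (Ioi 0)) :=
      hφL.integrable_mul hyL
    have : (fun x => (y x - a * φ x) ^ 2)
        = fun x => y x ^ 2 + (a ^ 2 * φ x ^ 2 - 2 * a * (φ x * y x)) := by ext x; ring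
    have hi4 : Integrable (fun x => a ^ 2 * φ x ^ 2 - 2 * a * (φ x * y x))
      (volume.restrict (Ioi 0)) := (hi2.const_mul _).sub (hi3.const_mul _)
    rw [this, integral_add hi1 hi4, integral_sub (hi2.const_mul _) (hi3.const_mul _),
      integral_const_mul, integral_const_mul, horth, hφ1]
    ring
  rw [hexpand] at hzle
  have h3 : ∫ x in Ioi (0 : ℝ), y x ^ 2 ≤
      2 / m * (m / 2 * ((∫ x in Ioi (0 : ℝ), y x ^ 2) + a ^ 2)) := by
    have : 2 / m * (m / 2 * ((∫ x in Ioi (0 : ℝ), y x ^ 2) + a ^ 2))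
        = (∫ x in Ioi (0 : ℝ), y x ^ 2) + a ^ 2 := by field_simp
    rw [this]; nlinarith [sq_nonneg a]
  refine h3.trans ((mul_le_mul_of_nonneg_left hzle (by positivity)).trans (le_of_eq ?_))
  ring

theorem eq_of_hasDerivAt_zero_off_finite {u : ℝ → ℝ} (hL : 0 ≤ L) (E : Finset ℝ)
    (hu : ContinuousOn u (Ici 0))
    (hu' : ∀ x > L, x ∉ (E : Set ℝ) → HasDerivAt u 0 x) {x : ℝ} (hx : L ≤ x) : u x = u L := by
  have := integral_eq_of_hasDerivAt_off_countable_of_le u (fun _ => 0) hx E.countable_toSet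
    (hu.mono fun t ht => hL.trans ht.1) (fun t ht => hu' t ht.1.1 ht.2) (by simp)
  simp only [intervalIntegral.integral_zero] at this
  linarith

/-- A solution of the free equation with positive energy near infinity vanishes there as soon
as it decays. -/
theorem Sol1D.eq_zero_of_tendsto (h : Sol1D d lam g y y') (h0 : Tendsto y atTop (nhds 0))
    (hlam : 0 < lam) (hL : 0 ≤ L) (hdL : ∀ x ≥ L, d x = 0) (hgL : ∀ x ≥ L, g x = 0)
    {x : ℝ} (hx : L ≤ x) : y x = 0 ∧ y' x = 0 := by
  set k := Real.sqrt lam with hk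
  have hk0 : 0 < k := Real.sqrt_pos.2 hlam
  have hkk : lam = k ^ 2 := (Real.sq_sqrt hlam.le).symm
  have hy := h.continuousOn
  obtain ⟨-, hy', ⟨E, hE⟩, -⟩ := id h
  have hcos : ∀ t : ℝ, HasDerivAt (fun x => Real.cos (k * x)) (-Real.sin (k * t) * k) t := by
    intro t
    simpa using ((hasDerivAt_id t).const_mul k).cos
  have hsin : ∀ t : ℝ, HasDerivAt (fun x => Real.sin (k * x)) (Real.cos (k * t) * k) t := by
    intro t
    simpa using ((hasDerivAt_id t).const_mul k).sin
  have hE' : ∀ t > L, t ∉ (E : Set ℝ) → HasDerivAt y' (-k ^ 2 * y t) t := fun t ht htE =>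
    (hE t (hL.trans_lt ht) htE).congr_deriv (by
      rw [hdL t ht.le, hgL t ht.le, hkk]; ring)
  set u : ℝ → ℝ := fun x => y x * Real.cos (k * x) - y' x / k * Real.sin (k * x) with hu
  set w : ℝ → ℝ := fun x => y x * Real.sin (k * x) + y' x / k * Real.cos (k * x) with hw
  have hc1 : ContinuousOn (fun x => Real.cos (k * x)) (Ici 0) := by fun_prop
  have hc2 : ContinuousOn (fun x => Real.sin (k * x)) (Ici 0) := by fun_prop
  have huc : ∀ t, L ≤ t → u t = u L := fun t ht =>
    eq_of_hasDerivAt_zero_off_finite hL E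
      ((hy.mul hc1).sub ((hy'.div_const k).mul hc2)) (fun t ht htE => by
        refine (((h.hasDerivAt (hL.trans_lt ht)).mul (hcos t)).sub
          (((hE' t ht htE).div_const k).mul (hsin t))).congr_deriv ?_
        field_simp; ring) ht
  have hwc : ∀ t, L ≤ t → w t = w L := fun t ht =>
    eq_of_hasDerivAt_zero_off_finite hL E
      ((hy.mul hc2).add ((hy'.div_const k).mul hc1)) (fun t ht htE => by
        refine (((h.hasDerivAt (hL.trans_lt ht)).mul (hsin t)).add
          (((hE' t ht htE).div_const k).mul (hcos t))).congr_deriv ?_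
        field_simp; ring) ht
  have hyuw : ∀ t, L ≤ t → y t = u L * Real.cos (k * t) + w L * Real.sin (k * t) := by
    intro t ht
    rw [← huc t ht, ← hwc t ht]
    simp only [hu, hw]
    linear_combination (-y t) * Real.sin_sq_add_cos_sq (k * t)
  have hseq : ∀ b : ℝ, Tendsto (fun n : ℕ => (b + n * (2 * Real.pi)) / k) atTop atTop := by
    intro b
    exact (tendsto_atTop_add_const_left _ _ (tendsto_natCast_atTop_atTop.atTop_mul_const
      (by positivity))).atTop_div_const hk0
  have hconst : ∀ b : ℝ, u L * Real.cos b + w L * Real.sin b = 0 := by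
    intro b
    have h1 := h0.comp (hseq b)
    have h2 : Tendsto (fun _ : ℕ => u L * Real.cos b + w L * Real.sin b) atTop (nhds 0) := by
      refine h1.congr' ?_
      filter_upwards [(hseq b).eventually_ge_atTop L] with n hn
      rw [Function.comp_apply, hyuw _ hn, mul_div_cancel₀ _ hk0.ne',
        Real.cos_add_nat_mul_two_pi, Real.sin_add_nat_mul_two_pi]
    exact tendsto_nhds_unique tendsto_const_nhds h2
  have hu0 : u L = 0 := by simpa using hconst 0
  have hw0 : w L = 0 := by simpa using hconst (Real.pi / 2)
  have hyx : y x = 0 := by rw [hyuw x hx, hu0, hw0]; ring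
  refine ⟨hyx, ?_⟩
  have e1 := huc x hx
  have e2 := hwc x hx
  rw [hu0] at e1
  rw [hw0] at e2
  simp only [hu, hw, hyx, zero_mul, zero_sub, zero_add, neg_eq_zero] at e1 e2
  have : y' x / k = 0 := by
    linear_combination (-(y' x / k)) * Real.sin_sq_add_cos_sq (k * x)
      + Real.sin (k * x) * e1 + Real.cos (k * x) * e2
  simpa [hk0.ne'] using this

theorem Sol1D.integral_sq_le_of_vanishing (h : Sol1D d lam g y y')
    (hd : AEStronglyMeasurable d volume) (hK : ∀ x, |d x - lam| ≤ K)
    (hg : MemLp g 2 (volume.restrict (Ioi 0))) (hL : 0 ≤ L)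
    (hyL : ∀ x ≥ L, y x = 0 ∧ y' x = 0) :
    MemLp y 2 (volume.restrict (Ioi 0)) ∧ ∫ x in Ioi (0 : ℝ), y x ^ 2 ≤
      L * Real.exp ((2 + K) * L) * ∫ x in Ioi (0 : ℝ), g x ^ 2 := by
  have hK0 : 0 ≤ K := (abs_nonneg _).trans (hK 0)
  have hG0 : 0 ≤ ∫ x in Ioi (0 : ℝ), g x ^ 2 := integral_nonneg fun x => sq_nonneg _
  set B := Real.exp ((2 + K) * L) * ∫ x in Ioi (0 : ℝ), g x ^ 2 with hB
  have hint : IntegrableOn ((Ioc 0 L).indicator fun _ => B) (Ioi 0) :=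
    ((integrableOn_const (by simp)).integrable_indicator measurableSet_Ioc).integrableOn
  have hle : ∀ x ∈ Ioi (0 : ℝ), y x ^ 2 ≤ (Ioc 0 L).indicator (fun _ => B) x := by
    intro x hx
    by_cases hxL : x ≤ L
    · rw [indicator_of_mem (show x ∈ Ioc 0 L from ⟨hx, hxL⟩)]
      have h1 := (h.sq_add_sq_le hd hK hg (le_of_lt hx) hxL).2
      simp only [hyL L le_rfl, ne_eq, OfNat.ofNat_ne_zero, not_false_eq_true, zero_pow,
        zero_add] at h1
      have h2 : Real.exp ((2 + K) * (L - x)) ≤ Real.exp ((2 + K) * L) :=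
        Real.exp_le_exp.2 (mul_le_mul_of_nonneg_left (by linarith [mem_Ioi.1 hx]) (by linarith))
      nlinarith [sq_nonneg (y' x), mul_le_mul_of_nonneg_right h2 hG0]
    · rw [indicator_of_notMem (fun hmem => hxL hmem.2), (hyL x (not_le.1 hxL).le).1]
      simp
  have hmeas := aestronglyMeasurable_of_continuousOn_Ici h.continuousOn
  have hi : IntegrableOn (fun x => y x ^ 2) (Ioi 0) := by
    refine Integrable.mono' hint (hmeas.pow 2) ?_
    filter_upwards [ae_restrict_mem measurableSet_Ioi] with x hx
    simpa using hle x hx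
  refine ⟨(memLp_two_iff_integrable_sq hmeas).2 hi, ?_⟩
  have := setIntegral_mono_on hi hint measurableSet_Ioi hle
  rw [setIntegral_indicator measurableSet_Ioc,
    inter_eq_self_of_subset_right Ioc_subset_Ioi_self, setIntegral_const] at this
  simpa [hL, hB, mul_assoc] using this

end Estimates
section VectorL2

/-- Componentwise square integrability on `(0,∞)`. -/
def MemL2 (f : ℝ → Fin 3 → ℝ) : Prop :=
  ∀ i, MemLp (fun x => f x i) 2 (volume.restrict (Ioi (0 : ℝ)))

variable {f g : ℝ → Fin 3 → ℝ}

theorem MemL2.integrable_sum_sq (hf : MemL2 f) :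
    Integrable (fun x => ∑ i, f x i ^ 2) (volume.restrict (Ioi 0)) :=
  integrable_finsetSum _ fun i _ => (hf i).integrable_sq

theorem MemL2.add (hf : MemL2 f) (hg : MemL2 g) : MemL2 (fun x i => f x i + g x i) :=
  fun i => (hf i).add (hg i)

theorem MemL2.sum {ι : Type*} {s : Finset ι} {f : ι → ℝ → Fin 3 → ℝ}
    (hf : ∀ k ∈ s, MemL2 (f k)) : MemL2 (fun x i => ∑ k ∈ s, f k x i) :=
  fun i => memLp_finsetSum s fun k hk => hf k hk i

theorem MemLp.bounded_mul {c f : ℝ → ℝ} {B : ℝ} (hc : AEStronglyMeasurable c volume)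
    (hB : ∀ x, |c x| ≤ B) (hf : MemLp f 2 (volume.restrict (Ioi (0 : ℝ)))) :
    MemLp (fun x => c x * f x) 2 (volume.restrict (Ioi (0 : ℝ))) :=
  hf.of_le_mul (hc.restrict.mul hf.1) (Eventually.of_forall fun x => by
    rw [norm_mul]
    exact mul_le_mul_of_nonneg_right (hB x) (norm_nonneg _))

theorem vecL2_nonneg (f : ℝ → Fin 3 → ℝ) : 0 ≤ vecL2 f := Real.sqrt_nonneg _

theorem vecL2_sq (f : ℝ → Fin 3 → ℝ) :
    vecL2 f ^ 2 = ∫ x in Ioi (0 : ℝ), ∑ i, f x i ^ 2 :=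
  Real.sq_sqrt (integral_nonneg fun _ => Finset.sum_nonneg fun _ _ => sq_nonneg _)

theorem MemL2.vecL2_sq_eq_sum (hf : MemL2 f) :
    vecL2 f ^ 2 = ∑ i, ∫ x in Ioi (0 : ℝ), f x i ^ 2 := by
  rw [vecL2_sq, integral_finsetSum _ fun i _ => (hf i).integrable_sq]

theorem MemL2.integral_sq_le (hf : MemL2 f) (i : Fin 3) :
    ∫ x in Ioi (0 : ℝ), f x i ^ 2 ≤ vecL2 f ^ 2 := by
  rw [hf.vecL2_sq_eq_sum]
  exact Finset.single_le_sum (f := fun i => ∫ x in Ioi (0 : ℝ), f x i ^ 2)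
    (fun j _ => integral_nonneg fun x => sq_nonneg _) (Finset.mem_univ i)

theorem MemL2.memLp_toLp (hf : MemL2 f) :
    MemLp (fun x => (WithLp.toLp 2 (f x) : EuclideanSpace ℝ (Fin 3))) 2
      (volume.restrict (Ioi (0 : ℝ))) :=
  MemLp.of_eval_piLp fun i => hf i

theorem MemL2.vecL2_eq_eLpNorm (hf : MemL2 f) :
    vecL2 f = (eLpNorm (fun x => (WithLp.toLp 2 (f x) : EuclideanSpace ℝ (Fin 3))) 2
      (volume.restrict (Ioi (0 : ℝ)))).toReal := by
  rw [hf.memLp_toLp.eLpNorm_eq_integral_rpow_norm (by norm_num) (by norm_num),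
    ENNReal.toReal_ofReal (by positivity), vecL2, Real.sqrt_eq_rpow]
  congr 1
  · refine integral_congr_ae (Eventually.of_forall fun x => ?_)
    simp [EuclideanSpace.norm_sq_eq]
  · norm_num

theorem MemL2.vecL2_add_le (hf : MemL2 f) (hg : MemL2 g) :
    vecL2 (fun x i => f x i + g x i) ≤ vecL2 f + vecL2 g := by
  have hadd : (fun x => (WithLp.toLp 2 (fun i => f x i + g x i) : EuclideanSpace ℝ (Fin 3)))
      = (fun x => WithLp.toLp 2 (f x)) + fun x => WithLp.toLp 2 (g x) := by
    ext x i
    simp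
  rw [hf.vecL2_eq_eLpNorm, hg.vecL2_eq_eLpNorm, (hf.add hg).vecL2_eq_eLpNorm, hadd,
    ← ENNReal.toReal_add hf.memLp_toLp.eLpNorm_ne_top hg.memLp_toLp.eLpNorm_ne_top]
  exact ENNReal.toReal_mono
    (ENNReal.add_ne_top.2 ⟨hf.memLp_toLp.eLpNorm_ne_top, hg.memLp_toLp.eLpNorm_ne_top⟩)
    (eLpNorm_add_le hf.memLp_toLp.1 hg.memLp_toLp.1 (by norm_num))

theorem vecL2_zero : vecL2 (fun _ _ => 0) = 0 := by simp [vecL2]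

theorem MemL2.vecL2_sum_le {ι : Type*} (s : Finset ι) {f : ι → ℝ → Fin 3 → ℝ}
    (hf : ∀ k ∈ s, MemL2 (f k)) :
    vecL2 (fun x i => ∑ k ∈ s, f k x i) ≤ ∑ k ∈ s, vecL2 (f k) := by
  classical
  induction s using Finset.induction_on with
  | empty => simp [vecL2_zero]
  | insert a s ha ih =>
    have h1 : ∀ k ∈ s, MemL2 (f k) := fun k hk => hf k (Finset.mem_insert_of_mem hk)
    simp only [Finset.sum_insert ha]
    exact ((hf a (Finset.mem_insert_self a s)).vecL2_add_le (MemL2.sum h1)).trans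
      (by gcongr; exact ih h1)

theorem MemL2.vecL2_le_mul (hg : MemL2 g) {c : ℝ} (hc : 0 ≤ c)
    (hfg : ∀ x, ∑ i, f x i ^ 2 ≤ c ^ 2 * ∑ i, g x i ^ 2) : vecL2 f ≤ c * vecL2 g := by
  refine Real.sqrt_le_iff.2 ⟨mul_nonneg hc (vecL2_nonneg g), ?_⟩
  rw [mul_pow, vecL2_sq, ← integral_const_mul]
  exact integral_mono_of_nonneg
    (Eventually.of_forall fun x => Finset.sum_nonneg fun i _ => sq_nonneg _)
    (hg.integrable_sum_sq.const_mul _) (Eventually.of_forall hfg)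

theorem MemL2.vecL2_mul_le (hg : MemL2 g) {c : ℝ → Fin 3 → ℝ} {B : ℝ}
    (hB : ∀ x i, |c x i| ≤ B) : vecL2 (fun x i => c x i * g x i) ≤ B * vecL2 g := by
  refine hg.vecL2_le_mul ((abs_nonneg _).trans (hB 0 0)) fun x => ?_
  rw [Finset.mul_sum]
  refine Finset.sum_le_sum fun i _ => ?_
  rw [mul_pow]
  gcongr ?_ * _
  exact sq_le_sq' (abs_le.1 (hB x i)).1 (abs_le.1 (hB x i)).2

theorem MemL2.vecL2_matrix_mul_le (hg : MemL2 g) {A : ℝ → Fin 3 → Fin 3 → ℝ} {B : ℝ}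
    (hB : ∀ x i j, |A x i j| ≤ B) :
    vecL2 (fun x i => ∑ j, A x i j * g x j) ≤ 3 * B * vecL2 g := by
  have hB0 : 0 ≤ B := (abs_nonneg _).trans (hB 0 0 0)
  refine hg.vecL2_le_mul (by positivity) fun x => ?_
  have hrow : ∀ i, (∑ j, A x i j * g x j) ^ 2 ≤ 3 * B ^ 2 * ∑ j, g x j ^ 2 := by
    intro i
    refine (Finset.sum_mul_sq_le_sq_mul_sq _ _ _).trans ?_
    gcongr
    calc ∑ j, A x i j ^ 2 ≤ ∑ _j : Fin 3, B ^ 2 := Finset.sum_le_sum fun j _ =>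
          sq_le_sq' (abs_le.1 (hB x i j)).1 (abs_le.1 (hB x i j)).2
      _ = 3 * B ^ 2 := by simp
  calc ∑ i, (∑ j, A x i j * g x j) ^ 2 ≤ ∑ _i : Fin 3, 3 * B ^ 2 * ∑ j, g x j ^ 2 :=
        Finset.sum_le_sum fun i _ => hrow i
    _ = (3 * B) ^ 2 * ∑ j, g x j ^ 2 := by
        rw [Finset.sum_const, Finset.card_univ, Fintype.card_fin, nsmul_eq_mul]; push_cast; ring

theorem MemL2.matrix_mul (hg : MemL2 g) {A : ℝ → Fin 3 → Fin 3 → ℝ} {B : ℝ}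
    (hA : ∀ i j, AEStronglyMeasurable (fun x => A x i j) volume)
    (hB : ∀ x i j, |A x i j| ≤ B) : MemL2 (fun x i => ∑ j, A x i j * g x j) :=
  fun i => memLp_finsetSum _ fun j _ => MemLp.bounded_mul (hA i j) (fun x => hB x i j) (hg j)

theorem abs_integral_mul_le_sqrt {a b : ℝ → ℝ} {μ : Measure ℝ}
    (ha : MemLp a 2 μ) (hb : MemLp b 2 μ) :
    |∫ x, a x * b x ∂μ| ≤ Real.sqrt (∫ x, a x ^ 2 ∂μ) * Real.sqrt (∫ x, b x ^ 2 ∂μ) := by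
  have hab : Integrable (fun x => a x * b x) μ := ha.integrable_mul hb
  have hquad : ∀ t : ℝ, 0 ≤ (∫ x, a x ^ 2 ∂μ) * (t * t) + (-2 * ∫ x, a x * b x ∂μ) * t
      + ∫ x, b x ^ 2 ∂μ := by
    intro t
    have h1 : ∫ x, (t * a x - b x) ^ 2 ∂μ = (∫ x, a x ^ 2 ∂μ) * (t * t)
        + (-2 * ∫ x, a x * b x ∂μ) * t + ∫ x, b x ^ 2 ∂μ := by
      have h2 : (fun x => (t * a x - b x) ^ 2)
          = fun x => (t * t * a x ^ 2 - 2 * t * (a x * b x)) + b x ^ 2 := by ext x; ring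
      have h3 : Integrable (fun x => t * t * a x ^ 2 - 2 * t * (a x * b x)) μ :=
        (ha.integrable_sq.const_mul _).sub (hab.const_mul _)
      rw [h2, integral_add h3 hb.integrable_sq, integral_sub
        (ha.integrable_sq.const_mul _) (hab.const_mul _),
        integral_const_mul, integral_const_mul]
      ring
    rw [← h1]
    exact integral_nonneg fun x => sq_nonneg _
  have hd := discrim_le_zero hquad
  rw [← Real.sqrt_mul (integral_nonneg fun x => sq_nonneg _)]
  refine Real.abs_le_sqrt ?_
  rw [discrim] at hd
  linarith

theorem MemL2.abs_integral_mul_le (hf : MemL2 f) {a : ℝ → ℝ}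
    (ha : MemLp a 2 (volume.restrict (Ioi (0 : ℝ)))) (i : Fin 3) :
    |∫ x in Ioi (0 : ℝ), a x * f x i| ≤
      Real.sqrt (∫ x in Ioi (0 : ℝ), a x ^ 2) * vecL2 f := by
  refine (abs_integral_mul_le_sqrt ha (hf i)).trans ?_
  gcongr
  exact Real.sqrt_le_iff.2 ⟨vecL2_nonneg f, hf.integral_sq_le i⟩

theorem aestronglyMeasurable_of_continuousAt_off_finset {E : Finset ℝ} {f : ℝ → ℝ}
    (hf : ∀ x ∉ (E : Set ℝ), ContinuousAt f x) : AEStronglyMeasurable f volume := by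
  have h1 : AEStronglyMeasurable f (volume.restrict (E : Set ℝ)ᶜ) :=
    ContinuousOn.aestronglyMeasurable (fun x hx => (hf x hx).continuousWithinAt)
      E.measurableSet.compl
  rwa [Measure.restrict_eq_self_of_ae_mem] at h1
  exact E.countable_toSet.ae_notMem volume

end VectorL2

section System

variable {D : ℝ → Fin 3 → ℝ} {lam K L : ℝ} {g y y' : ℝ → Fin 3 → ℝ}

theorem DiagBVPSol.component (h : DiagBVPSol D lam g y y') (i : Fin 3) :
    Sol1D (fun x => D x i) lam (fun x => g x i) (fun x => y x i) (fun x => y' x i) := by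
  obtain ⟨h1, h2, ⟨E, hE⟩, h4, -⟩ := h
  exact ⟨fun x hx => hasDerivWithinAt_pi.1 (h1 x hx) i, continuousOn_pi.1 h2 i,
    ⟨E, fun x hx hxE => hasDerivAt_pi.1 (hE x hx hxE) i⟩, congrFun h4 i⟩

theorem DiagBVPSol.tendsto_component (h : DiagBVPSol D lam g y y') (i : Fin 3) :
    Tendsto (fun x => y x i) atTop (nhds 0) :=
  tendsto_pi_nhds.1 h.2.2.2.2 i

theorem DiagBVPSol.vecH2_le (h : DiagBVPSol D lam g y y')
    (hD : ∀ i, AEStronglyMeasurable (fun x => D x i) volume)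
    (hK : ∀ x i, |D x i - lam| ≤ K) (hg : MemL2 g) (hy : MemL2 y) :
    vecH2 y y' ≤ (2 + 2 * K) * (vecL2 y + vecL2 g) := by
  have hK0 : 0 ≤ K := (abs_nonneg _).trans (hK 0 0)
  have hsc := fun i => (h.component i).integral_deriv_sq_le (h.tendsto_component i) (hD i)
    (fun x => hK x i) (hg i) (hy i)
  have hy' : MemL2 y' := fun i => (hsc i).1
  have h1 : ∫ x in Ioi (0 : ℝ), ∑ i, y' x i ^ 2
      ≤ (1 / 2) * vecL2 g ^ 2 + (1 / 2 + K) * vecL2 y ^ 2 := by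
    rw [← vecL2_sq, hy'.vecL2_sq_eq_sum, hg.vecL2_sq_eq_sum, hy.vecL2_sq_eq_sum,
      Finset.mul_sum, Finset.mul_sum, ← Finset.sum_add_distrib]
    exact Finset.sum_le_sum fun i _ => (hsc i).2
  have h2 : ∫ x in Ioi (0 : ℝ), ∑ i, deriv (fun t => y' t i) x ^ 2
      ≤ 2 * K ^ 2 * vecL2 y ^ 2 + 2 * vecL2 g ^ 2 := by
    rw [vecL2_sq, vecL2_sq, ← integral_const_mul, ← integral_const_mul,
      ← integral_add (hy.integrable_sum_sq.const_mul _) (hg.integrable_sum_sq.const_mul _)]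
    obtain ⟨E, hE⟩ := h.2.2.1
    refine integral_mono_of_nonneg
      (Eventually.of_forall fun x => Finset.sum_nonneg fun i _ => sq_nonneg _)
      ((hy.integrable_sum_sq.const_mul _).add (hg.integrable_sum_sq.const_mul _)) ?_
    filter_upwards [ae_restrict_mem measurableSet_Ioi,
      ae_restrict_of_ae (E.countable_toSet.ae_notMem volume)] with x hx hxE
    rw [Finset.mul_sum, Finset.mul_sum, ← Finset.sum_add_distrib]
    refine Finset.sum_le_sum fun i _ => ?_
    rw [(hasDerivAt_pi.1 (hE x hx hxE) i).deriv]
    have h3 : (D x i - lam) ^ 2 ≤ K ^ 2 :=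
      sq_le_sq' (abs_le.1 (hK x i)).1 (abs_le.1 (hK x i)).2
    nlinarith [sq_nonneg ((D x i - lam) * y x i + g x i),
      mul_le_mul_of_nonneg_right h3 (sq_nonneg (y x i))]
  have hy0 := vecL2_nonneg y
  have hg0 := vecL2_nonneg g
  refine Real.sqrt_le_iff.2 ⟨by positivity, ?_⟩
  rw [← vecL2_sq y]
  nlinarith [mul_nonneg hy0 hg0, mul_nonneg hK0 (sq_nonneg (vecL2 y)),
    mul_nonneg hK0 (sq_nonneg (vecL2 g)), mul_nonneg (sq_nonneg K) (sq_nonneg (vecL2 y)),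
    mul_nonneg (sq_nonneg K) (sq_nonneg (vecL2 g)), sq_nonneg (vecL2 y), sq_nonneg (vecL2 g),
    mul_nonneg (sq_nonneg (2 + 2 * K)) (mul_nonneg hy0 hg0)]

/-- The `L²` estimate for solutions of the uncoupled system orthogonal to both bound states. -/
theorem DiagBVPSol.exists_vecL2_le (hL : 0 ≤ L) (hlam : lam ∈ Ioo (0 : ℝ) 1)
    (hD : ∀ i, AEStronglyMeasurable (fun x => D x i) volume)
    (hK : ∀ x i, |D x i - lam| ≤ K) (hDL : ∀ x ≥ L, D x = ![0, 1, 1])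
    {φ1 φ1' φ2 φ2' : ℝ → ℝ}
    (hφ1 : IsBoundState1D (fun x => D x 1) lam φ1 φ1')
    (hφ2 : IsBoundState1D (fun x => D x 2) lam φ2 φ2')
    (hφ1norm : ∫ x in Ioi (0 : ℝ), φ1 x ^ 2 = 1) (hφ2norm : ∫ x in Ioi (0 : ℝ), φ2 x ^ 2 = 1) :
    ∃ C : ℝ, 0 ≤ C ∧ ∀ g y y', DiagBVPSol D lam g y y' → MemL2 g → (∀ x ≥ L, g x 0 = 0) →
      ∫ x in Ioi (0 : ℝ), φ1 x * y x 1 = 0 → ∫ x in Ioi (0 : ℝ), φ2 x * y x 2 = 0 →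
      MemL2 y ∧ (∀ x ≥ L, y x 0 = 0) ∧ vecL2 y ≤ C * vecL2 g := by
  have hm : 0 < 1 - lam := sub_pos.2 hlam.2
  have hK0 : 0 ≤ K := (abs_nonneg _).trans (hK 0 0)
  obtain ⟨c1, hc1, h1⟩ := hφ1.exists_integral_sq_le hφ1norm (hD 1) (fun x => hK x 1) hL hm
    (fun x hx => by simp [hDL x hx])
  obtain ⟨c2, hc2, h2⟩ := hφ2.exists_integral_sq_le hφ2norm (hD 2) (fun x => hK x 2) hL hm
    (fun x hx => by simp [hDL x hx])
  set c0 := L * Real.exp ((2 + K) * L) with hc0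
  have hc0' : 0 ≤ c0 := by positivity
  refine ⟨Real.sqrt (c0 + c1 + c2), Real.sqrt_nonneg _, fun g y y' hs hg hg0 ho1 ho2 => ?_⟩
  have hvan : ∀ x ≥ L, y x 0 = 0 ∧ y' x 0 = 0 := fun x hx =>
    (hs.component 0).eq_zero_of_tendsto (hs.tendsto_component 0) hlam.1 hL
      (fun t ht => by simp [hDL t ht]) hg0 hx
  obtain ⟨m0, e0⟩ := (hs.component 0).integral_sq_le_of_vanishing (hD 0) (fun x => hK x 0) (hg 0)
    hL hvan
  obtain ⟨m1, e1⟩ := h1 _ _ _ (hs.component 1) (hs.tendsto_component 1) (hg 1) ho1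
  obtain ⟨m2, e2⟩ := h2 _ _ _ (hs.component 2) (hs.tendsto_component 2) (hg 2) ho2
  have hy : MemL2 y := by intro i; fin_cases i <;> assumption
  refine ⟨hy, fun x hx => (hvan x hx).1, ?_⟩
  have hpos := vecL2_nonneg g
  have hsq : vecL2 y ^ 2 ≤ (c0 + c1 + c2) * vecL2 g ^ 2 := by
    rw [hy.vecL2_sq_eq_sum, Fin.sum_univ_three]
    have i0 := mul_le_mul_of_nonneg_left (hg.integral_sq_le 0) hc0'
    have i1 := mul_le_mul_of_nonneg_left (hg.integral_sq_le 1) hc1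
    have i2 := mul_le_mul_of_nonneg_left (hg.integral_sq_le 2) hc2
    linarith
  calc vecL2 y ≤ Real.sqrt ((c0 + c1 + c2) * vecL2 g ^ 2) := Real.le_sqrt_of_sq_le hsq
    _ = _ := by rw [Real.sqrt_mul (by positivity), Real.sqrt_sq hpos]

variable {D1 : ℝ → Fin 3 → ℝ} {F : ℝ → Fin 3 → Fin 3 → ℝ} {B : ℝ}
  {lamseq sseq : ℕ → ℝ} {Y : ℕ → ℝ → Fin 3 → ℝ} {n : ℕ}

theorem abs_mul_sub_le {s a l : ℝ} (ha : |a| ≤ B) : |s * a - l| ≤ B * |s| + |l| := by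
  refine (abs_sub _ _).trans ?_
  rw [abs_mul, mul_comm]
  gcongr

theorem MemL2.mul_sub (hD1 : ∀ i, AEStronglyMeasurable (fun x => D1 x i) volume)
    (hB : ∀ x i, |D1 x i| ≤ B) (hy : MemL2 y) (s l : ℝ) :
    MemL2 (fun x i => (s * D1 x i - l) * y x i) := fun i =>
  MemLp.bounded_mul (((hD1 i).const_mul s).sub aestronglyMeasurable_const)
    (fun x => abs_mul_sub_le (hB x i)) (hy i)

theorem memL2_Hseq (hD1 : ∀ i, AEStronglyMeasurable (fun x => D1 x i) volume)
    (hB : ∀ x i, |D1 x i| ≤ B) (hF : ∀ i j, AEStronglyMeasurable (fun x => F x i j) volume)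
    (hFB : ∀ x i j, |F x i j| ≤ B) (hY : MemL2 (Y (n - 1)))
    (hY' : ∀ k ∈ Finset.Icc 1 (n - 1), MemL2 (Y (n - k))) :
    MemL2 (Hseq D1 F lamseq sseq Y n) :=
  (hY.matrix_mul hF hFB).add (MemL2.sum fun k hk => (hY' k hk).mul_sub hD1 hB _ _)

theorem vecL2_Hseq_le (hD1 : ∀ i, AEStronglyMeasurable (fun x => D1 x i) volume)
    (hB : ∀ x i, |D1 x i| ≤ B) (hF : ∀ i j, AEStronglyMeasurable (fun x => F x i j) volume)
    (hFB : ∀ x i j, |F x i j| ≤ B) (hY : MemL2 (Y (n - 1)))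
    (hY' : ∀ k ∈ Finset.Icc 1 (n - 1), MemL2 (Y (n - k))) :
    vecL2 (Hseq D1 F lamseq sseq Y n) ≤ 3 * B * vecL2 (Y (n - 1)) +
      ∑ k ∈ Finset.Icc 1 (n - 1), (B * |sseq k| + |lamseq k|) * vecL2 (Y (n - k)) := by
  have hterm : ∀ k ∈ Finset.Icc 1 (n - 1),
      MemL2 (fun x i => (sseq k * D1 x i - lamseq k) * Y (n - k) x i) :=
    fun k hk => (hY' k hk).mul_sub hD1 hB _ _
  refine ((hY.matrix_mul hF hFB).vecL2_add_le (MemL2.sum hterm)).trans ?_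
  refine add_le_add (hY.vecL2_matrix_mul_le hFB) ((MemL2.vecL2_sum_le _ hterm).trans ?_)
  exact Finset.sum_le_sum fun k hk =>
    (hY' k hk).vecL2_mul_le fun x i => abs_mul_sub_le (hB x i)

theorem Hseq_zero_of_ge (hFL : ∀ x ≥ L, F x = 0) {x : ℝ} (hx : x ≥ L)
    (hY : ∀ k ∈ Finset.Icc 1 (n - 1), Y (n - k) x 0 = 0) :
    Hseq D1 F lamseq sseq Y n x 0 = 0 := by
  rw [Hseq, hFL x hx, Finset.sum_eq_zero (s := Finset.Icc 1 (n - 1)) fun k hk => by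
    rw [hY k hk, mul_zero]]
  simp

theorem Gseq_eq (hn : 1 ≤ n) (x : ℝ) (i : Fin 3) :
    Gseq D1 F lamseq sseq Y n x i =
      -((sseq n * D1 x i - lamseq n) * Y 0 x i + Hseq D1 F lamseq sseq Y n x i) := by
  obtain ⟨m, rfl⟩ := Nat.exists_eq_add_of_le' hn
  simp only [Gseq, Hseq]
  rw [Finset.sum_Icc_succ_top (by omega)]
  have : ∑ k ∈ Finset.Icc 1 m, (lamseq k - sseq k * D1 x i) * Y (m + 1 - k) x i
      = -∑ k ∈ Finset.Icc 1 m, (sseq k * D1 x i - lamseq k) * Y (m + 1 - k) x i := by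
    rw [← Finset.sum_neg_distrib]
    exact Finset.sum_congr rfl fun k _ => by ring
  rw [this]
  simp only [Nat.sub_self, Nat.add_sub_cancel]
  ring

theorem vecL2_neg (f : ℝ → Fin 3 → ℝ) : vecL2 (fun x i => -f x i) = vecL2 f := by
  simp [vecL2]

theorem sum_Icc_one_le {a : ℕ → ℝ} (ha : ∀ k, 0 ≤ a k) (N : ℕ) :
    ∑ k ∈ Finset.Icc 1 N, a k ≤ a 1 + ∑ k ∈ Finset.Icc 2 N, a k := by
  rw [← Finset.sum_insert (by simp)]
  refine Finset.sum_le_sum_of_subset_of_nonneg (fun k hk => ?_) fun k _ _ => ha k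
  simp only [Finset.mem_insert, Finset.mem_Icc] at hk ⊢
  omega

theorem sum_Icc_one_le_of_pos {a : ℕ → ℝ} (ha : ∀ k, 0 ≤ a k) (hn : 1 ≤ n) :
    ∑ k ∈ Finset.Icc 1 n, a k ≤ a 1 + a n + ∑ k ∈ Finset.Icc 2 (n - 1), a k := by
  obtain ⟨m, rfl⟩ := Nat.exists_eq_add_of_le' hn
  rw [Finset.sum_Icc_succ_top (by omega), Nat.add_sub_cancel]
  linarith [sum_Icc_one_le ha m]

end System
/-- Lemma 6.2: under assumptions A1, A2, A3, for the recursive construction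
`(y_n, λ_n, s_n, γ_n)` of Theorem 6.1, there exist constants `M1, M2, M3`
independent of `n` such that for all `n ≥ 1`:
(a) `‖g_n‖ ≤ M1 ‖h_n‖`;
(b) `‖h_n‖ ≤ M2 (‖y_{n-1}‖ + Σ_{i=2}^{n-1} ‖y_{n-i}‖·‖h_i‖)`;
(c) `‖y_n‖_{H²} ≤ M3 (‖h_n‖ + Σ_{i=2}^{n-1} ‖h_i‖·‖h_{n+1-i}‖)`. -/
theorem lemma_6_2_norm_estimates
    (L s0 lam0 θ0 : ℝ) (hL : 0 < L) (hlam0 : lam0 ∈ Set.Ioo (0 : ℝ) 1)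
    (D0 D1 : ℝ → Fin 3 → ℝ) (F : ℝ → Fin 3 → Fin 3 → ℝ)
    (ED : Finset ℝ)
    (hD0sm : ∀ x ∉ (ED : Set ℝ), ContDiffAt ℝ (⊤ : ℕ∞) D0 x)
    (hD1sm : ∀ x ∉ (ED : Set ℝ), ContDiffAt ℝ (⊤ : ℕ∞) D1 x)
    (hFsm : ∀ x ∉ (ED : Set ℝ), ContDiffAt ℝ (⊤ : ℕ∞) F x)
    (CB : ℝ)
    (hbdd : ∀ x, (∀ i, |D0 x i| ≤ CB ∧ |D1 x i| ≤ CB) ∧ ∀ i j, |F x i j| ≤ CB)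
    (hD0L : ∀ x ≥ L, D0 x = ![0, 1, 1])
    (hD1L : ∀ x ≥ L, D1 x = 0)
    (hFL : ∀ x ≥ L, F x = 0)
    (hFsymm : ∀ x i j, F x i j = F x j i)
    (hFdiag : ∀ x i, F x i i = 0)
    -- assumption A2
    (φ1 φ1' φ2 φ2' : ℝ → ℝ)
    (hφ1 : IsBoundState1D (fun x => D0 x 1) lam0 φ1 φ1')
    (hφ2 : IsBoundState1D (fun x => D0 x 2) lam0 φ2 φ2')
    (hφ1norm : ∫ x in Set.Ioi (0 : ℝ), (φ1 x) ^ 2 = 1)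
    (hφ2norm : ∫ x in Set.Ioi (0 : ℝ), (φ2 x) ^ 2 = 1)
    (d11 d22 : ℝ)
    (hd11 : d11 = ∫ x in Set.Ioi (0 : ℝ), D1 x 1 * (φ1 x) ^ 2)
    (hd22 : d22 = ∫ x in Set.Ioi (0 : ℝ), D1 x 2 * (φ2 x) ^ 2)
    (hA2 : d11 ≠ d22)
    -- assumption A3
    (φ0 φ0' : ℝ → ℝ)
    (hφ0 : Sol1D (fun x => D0 x 0) lam0 (fun _ => 0) φ0 φ0')
    (hφ0L : ∀ x > L, φ0 x = Real.cos (Real.sqrt lam0 * x + θ0 / 2))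
    (C1 C2 : ℝ)
    (hC1 : C1 = ∫ x in Set.Ioi (0 : ℝ), φ0 x * (F x 0 2 * φ2 x))
    (hC2 : C2 = -(∫ x in Set.Ioi (0 : ℝ), φ0 x * (F x 0 1 * φ1 x)))
    (hA3a : C2 ≠ 0) (hA3b : C1 ≠ 0)
    (hA3n : C1 ^ 2 + C2 ^ 2 = 1)
    -- the recursive construction of Theorem 6.1
    (lamseq sseq gamseq : ℕ → ℝ)
    (Y Y' Yp Yp' : ℕ → ℝ → Fin 3 → ℝ)
    (hY0 : ∀ x, Y 0 x = ![0, C1 * φ1 x, C2 * φ2 x])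
    (hYsol : ∀ n, 1 ≤ n →
      DiagBVPSol D0 lam0 (Gseq D1 F lamseq sseq Y n) (Y n) (Y' n))
    (hYpsol : ∀ n, 1 ≤ n →
      DiagBVPSol D0 lam0 (Gseq D1 F lamseq sseq Y n) (Yp n) (Yp' n))
    (hYporth : ∀ n, 1 ≤ n →
      (∫ x in Set.Ioi (0 : ℝ), φ1 x * Yp n x 1) = 0 ∧
      (∫ x in Set.Ioi (0 : ℝ), φ2 x * Yp n x 2) = 0)
    (hdecomp : ∀ n, 1 ≤ n → ∀ x, Y n x = fun i =>
      Yp n x i + gamseq n * (![0, C2 * φ1 x, -(C1 * φ2 x)] : Fin 3 → ℝ) i)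
    -- (λ_n, s_n) solve A (λ_n, s_n)ᵀ = (⟨Φ1,h_n⟩, ⟨Φ2,h_n⟩)ᵀ
    (hlin : ∀ n, 1 ≤ n →
      C1 * lamseq n - C1 * d11 * sseq n =
        (∫ x in Set.Ioi (0 : ℝ), φ1 x * Hseq D1 F lamseq sseq Y n x 1) ∧
      C2 * lamseq n - C2 * d22 * sseq n =
        (∫ x in Set.Ioi (0 : ℝ), φ2 x * Hseq D1 F lamseq sseq Y n x 2))
    -- γ_n = ⟨Φ0, h_{n+1}⁽ᵖ⁾⟩
    (hgam : ∀ n, 1 ≤ n →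
      gamseq n = ∫ x in Set.Ioi (0 : ℝ),
        φ0 x * Hseq D1 F lamseq sseq Yp (n + 1) x 0) :
    ∃ M1 M2 M3 : ℝ, ∀ n, 1 ≤ n →
      vecL2 (Gseq D1 F lamseq sseq Y n) ≤
        M1 * vecL2 (Hseq D1 F lamseq sseq Y n) ∧
      vecL2 (Hseq D1 F lamseq sseq Y n) ≤
        M2 * (vecL2 (Y (n - 1)) +
          ∑ i ∈ Finset.Icc 2 (n - 1),
            vecL2 (Y (n - i)) * vecL2 (Hseq D1 F lamseq sseq Y i)) ∧
      vecH2 (Y n) (Y' n) ≤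
        M3 * (vecL2 (Hseq D1 F lamseq sseq Y n) +
          ∑ i ∈ Finset.Icc 2 (n - 1),
            vecL2 (Hseq D1 F lamseq sseq Y i) *
              vecL2 (Hseq D1 F lamseq sseq Y (n + 1 - i))) := by
  -- measurability and bounds of the coefficients
  have hD0m : ∀ i, AEStronglyMeasurable (fun x => D0 x i) volume := fun i =>
    aestronglyMeasurable_of_continuousAt_off_finset (E := ED) fun x hx =>
      continuousAt_pi.1 (hD0sm x hx).continuousAt i
  have hD1m : ∀ i, AEStronglyMeasurable (fun x => D1 x i) volume := fun i =>
    aestronglyMeasurable_of_continuousAt_off_finset (E := ED) fun x hx =>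
      continuousAt_pi.1 (hD1sm x hx).continuousAt i
  have hFm : ∀ i j, AEStronglyMeasurable (fun x => F x i j) volume := fun i j =>
    aestronglyMeasurable_of_continuousAt_off_finset (E := ED) fun x hx =>
      continuousAt_pi.1 (continuousAt_pi.1 (hFsm x hx).continuousAt i) j
  have hD1B : ∀ x i, |D1 x i| ≤ CB := fun x i => ((hbdd x).1 i).2
  have hFB : ∀ x i j, |F x i j| ≤ CB := fun x => (hbdd x).2
  have hCB : 0 ≤ CB := (abs_nonneg _).trans (hD1B 0 0)
  have hK : ∀ x i, |D0 x i - lam0| ≤ CB + 1 := fun x i => by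
    have h1 := abs_le.1 ((hbdd x).1 i).1
    rw [abs_le]
    constructor <;> linarith [hlam0.1, hlam0.2, h1.1, h1.2]
  have hm : 0 < 1 - lam0 := sub_pos.2 hlam0.2
  have hφ1L : MemLp φ1 2 (volume.restrict (Ioi 0)) :=
    hφ1.memLp (hD0m 1) (fun x => hK x 1) hL.le hm fun x hx => by simp [hD0L x hx]
  have hφ2L : MemLp φ2 2 (volume.restrict (Ioi 0)) :=
    hφ2.memLp (hD0m 2) (fun x => hK x 2) hL.le hm fun x hx => by simp [hD0L x hx]
  obtain ⟨Cp, hCp, hpart⟩ := DiagBVPSol.exists_vecL2_le hL.le hlam0 hD0m hK hD0L hφ1 hφ2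
    hφ1norm hφ2norm
  have hperp : MemL2 (fun x => ![0, C2 * φ1 x, -(C1 * φ2 x)]) := by
    intro i
    fin_cases i
    · exact MemLp.zero
    · exact hφ1L.const_mul C2
    · exact (hφ2L.const_mul C1).neg
  have hY0mem : MemL2 (Y 0) := by
    intro i
    simp only [hY0]
    fin_cases i
    · exact MemLp.zero
    · exact hφ1L.const_mul C1
    · exact hφ2L.const_mul C2
  have hGmem : ∀ n, 1 ≤ n → (∀ m < n, MemL2 (Y m)) → MemL2 (Hseq D1 F lamseq sseq Y n) →
      MemL2 (Gseq D1 F lamseq sseq Y n) := by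
    intro n hn hlt hH i
    have : (fun x => Gseq D1 F lamseq sseq Y n x i) = fun x =>
      -((sseq n * D1 x i - lamseq n) * Y 0 x i + Hseq D1 F lamseq sseq Y n x i) :=
      funext fun x => Gseq_eq hn x i
    rw [this]
    exact (((hlt 0 hn).mul_sub hD1m hD1B _ _ i).add (hH i)).neg
  have hHmem' : ∀ n, 1 ≤ n → (∀ m < n, MemL2 (Y m)) → MemL2 (Hseq D1 F lamseq sseq Y n) := by
    intro n hn hlt
    refine memL2_Hseq hD1m hD1B hFm hFB (hlt _ (by omega)) fun k hk => hlt _ ?_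
    rw [Finset.mem_Icc] at hk
    omega
  -- the inductive step: a priori estimate for the particular solution
  have hstep : ∀ n, 1 ≤ n → (∀ m < n, MemL2 (Y m) ∧ ∀ x ≥ L, Y m x 0 = 0) →
      MemL2 (Yp n) ∧ (∀ x ≥ L, Yp n x 0 = 0) ∧
        vecL2 (Yp n) ≤ Cp * vecL2 (Gseq D1 F lamseq sseq Y n) := by
    intro n hn hlt
    have hlt' : ∀ m < n, MemL2 (Y m) := fun m hmn => (hlt m hmn).1
    refine hpart _ _ _ (hYpsol n hn) (hGmem n hn hlt' (hHmem' n hn hlt')) (fun x hx => ?_)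
      (hYporth n hn).1 (hYporth n hn).2
    rw [Gseq_eq hn, (hlt 0 hn).2 x hx, Hseq_zero_of_ge hFL hx]
    · simp
    · intro k hk
      rw [Finset.mem_Icc] at hk
      exact (hlt _ (by omega)).2 x hx
  have hYall : ∀ n, MemL2 (Y n) ∧ ∀ x ≥ L, Y n x 0 = 0 := by
    intro n
    induction n using Nat.strong_induction_on with
    | _ n ih =>
      rcases Nat.eq_zero_or_pos n with rfl | hn
      · exact ⟨hY0mem, fun x _ => by simp [hY0]⟩
      · obtain ⟨h1, h2, -⟩ := hstep n hn ih
        refine ⟨fun i => ?_, fun x hx => ?_⟩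
        · simp only [hdecomp n hn]
          exact (h1 i).add ((hperp i).const_mul _)
        · simp [hdecomp n hn, h2 x hx]
  have hYmem : ∀ n, MemL2 (Y n) := fun n => (hYall n).1
  have hHmem : ∀ n, 1 ≤ n → MemL2 (Hseq D1 F lamseq sseq Y n) := fun n hn =>
    hHmem' n hn fun m _ => hYmem m
  have hYp : ∀ n, 1 ≤ n → MemL2 (Yp n) ∧ (∀ x ≥ L, Yp n x 0 = 0) ∧
      vecL2 (Yp n) ≤ Cp * vecL2 (Gseq D1 F lamseq sseq Y n) := fun n hn =>
    hstep n hn fun m _ => hYall m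
  set N : ℕ → ℝ := fun n => vecL2 (Hseq D1 F lamseq sseq Y n) with hN
  have hN0 : ∀ n, 0 ≤ N n := fun n => vecL2_nonneg _
  -- bounds for the parameters
  set S : ℝ := (1 / |C1| + 1 / |C2|) / |d22 - d11| with hS
  set Λ : ℝ := 1 / |C1| + |d11| * S with hΛ
  have hS0 : 0 ≤ S := by positivity
  have hΛ0 : 0 ≤ Λ := by positivity
  have hpar : ∀ n, 1 ≤ n → |sseq n| ≤ S * N n ∧ |lamseq n| ≤ Λ * N n := by
    intro n hn
    obtain ⟨e1, e2⟩ := hlin n hn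
    have a1 := (hHmem n hn).abs_integral_mul_le hφ1L 1
    have a2 := (hHmem n hn).abs_integral_mul_le hφ2L 2
    rw [hφ1norm, Real.sqrt_one, one_mul, ← e1] at a1
    rw [hφ2norm, Real.sqrt_one, one_mul, ← e2] at a2
    have b1 : |lamseq n - d11 * sseq n| ≤ 1 / |C1| * N n := by
      rw [one_div, ← div_eq_inv_mul, le_div_iff₀ (abs_pos.2 hA3b), ← abs_mul]
      refine le_of_eq_of_le (congrArg _ ?_) a1
      ring
    have b2 : |lamseq n - d22 * sseq n| ≤ 1 / |C2| * N n := by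
      rw [one_div, ← div_eq_inv_mul, le_div_iff₀ (abs_pos.2 hA3a), ← abs_mul]
      refine le_of_eq_of_le (congrArg _ ?_) a2
      ring
    have hdpos : 0 < |d22 - d11| := abs_pos.2 (sub_ne_zero.2 hA2.symm)
    have hs : |sseq n| ≤ S * N n := by
      rw [hS, div_mul_eq_mul_div, le_div_iff₀ hdpos, ← abs_mul]
      calc |sseq n * (d22 - d11)|
          = |(lamseq n - d11 * sseq n) - (lamseq n - d22 * sseq n)| := by congr 1; ring
        _ ≤ _ := abs_sub _ _
        _ ≤ _ := by linarith
    refine ⟨hs, ?_⟩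
    calc |lamseq n| = |(lamseq n - d11 * sseq n) + d11 * sseq n| := by congr 1; ring
      _ ≤ |lamseq n - d11 * sseq n| + |d11| * |sseq n| := by
          rw [← abs_mul]; exact abs_add_le _ _
      _ ≤ 1 / |C1| * N n + |d11| * (S * N n) := by gcongr
      _ = Λ * N n := by rw [hΛ]; ring
  set c : ℝ := CB * S + Λ with hc
  have hc0 : 0 ≤ c := by positivity
  have hcoef : ∀ n, 1 ≤ n → CB * |sseq n| + |lamseq n| ≤ c * N n := by
    intro n hn
    obtain ⟨h1, h2⟩ := hpar n hn
    nlinarith [mul_le_mul_of_nonneg_left h1 hCB]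
  -- the first estimate
  set M1 : ℝ := c * vecL2 (Y 0) + 1 with hM1
  have hM10 : 0 ≤ M1 := by have := vecL2_nonneg (Y 0); positivity
  have ha : ∀ n, 1 ≤ n → vecL2 (Gseq D1 F lamseq sseq Y n) ≤ M1 * N n := by
    intro n hn
    have hG : Gseq D1 F lamseq sseq Y n = fun x i =>
        -((sseq n * D1 x i - lamseq n) * Y 0 x i + Hseq D1 F lamseq sseq Y n x i) := by
      funext x i
      exact Gseq_eq hn x i
    rw [hG, vecL2_neg]
    have hY00 := vecL2_nonneg (Y 0)
    calc _ ≤ vecL2 (fun x i => (sseq n * D1 x i - lamseq n) * Y 0 x i) + N n :=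
          ((hYmem 0).mul_sub hD1m hD1B _ _).vecL2_add_le (hHmem n hn)
      _ ≤ (CB * |sseq n| + |lamseq n|) * vecL2 (Y 0) + N n := by
          gcongr
          exact (hYmem 0).vecL2_mul_le fun x i => abs_mul_sub_le (hD1B x i)
      _ ≤ c * N n * vecL2 (Y 0) + N n := by
          gcongr
          exact hcoef n hn
      _ = M1 * N n := by rw [hM1]; ring
  -- the second estimate
  have hb : ∀ n, 1 ≤ n → N n ≤ (3 * CB + c * N 1 + c) * (vecL2 (Y (n - 1)) +
      ∑ i ∈ Finset.Icc 2 (n - 1), vecL2 (Y (n - i)) * N i) := by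
    intro n hn
    have h1 : N n ≤ _ := vecL2_Hseq_le (lamseq := lamseq) (sseq := sseq) (n := n) hD1m hD1B hFm
      hFB (hYmem (n - 1)) (fun k _ => hYmem (n - k))
    have h2 : ∑ k ∈ Finset.Icc 1 (n - 1), (CB * |sseq k| + |lamseq k|) * vecL2 (Y (n - k)) ≤
        ∑ k ∈ Finset.Icc 1 (n - 1), c * (vecL2 (Y (n - k)) * N k) := by
      refine Finset.sum_le_sum fun k hk => ?_
      have := mul_le_mul_of_nonneg_right (hcoef k (Finset.mem_Icc.1 hk).1)
        (vecL2_nonneg (Y (n - k)))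
      linarith
    rw [← Finset.mul_sum] at h2
    have hnn : ∀ k, 0 ≤ vecL2 (Y (n - k)) * N k := fun k => mul_nonneg (vecL2_nonneg _) (hN0 k)
    have h3 := mul_le_mul_of_nonneg_left (sum_Icc_one_le hnn (n - 1)) hc0
    have h4 : 0 ≤ ∑ i ∈ Finset.Icc 2 (n - 1), vecL2 (Y (n - i)) * N i :=
      Finset.sum_nonneg fun k _ => hnn k
    have h5 := vecL2_nonneg (Y (n - 1))
    have h6 := mul_nonneg (add_nonneg (mul_nonneg zero_le_three hCB) (mul_nonneg hc0 (hN0 1))) h4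
    have h7 := mul_nonneg hc0 h5
    linarith
  -- the third estimate
  set CY : ℝ := Cp * M1 with hCY
  have hCY0 : 0 ≤ CY := by positivity
  have hYpN : ∀ n, 1 ≤ n → vecL2 (Yp n) ≤ CY * N n := by
    intro n hn
    refine (hYp n hn).2.2.trans ?_
    rw [hCY, mul_assoc]
    exact mul_le_mul_of_nonneg_left (ha n hn) hCp
  obtain ⟨Cφ, hCφ0, hCφ⟩ : ∃ Cφ : ℝ, 0 ≤ Cφ ∧ ∀ h : ℝ → Fin 3 → ℝ, MemL2 h →
      (∀ x ≥ L, h x 0 = 0) → |∫ x in Ioi (0 : ℝ), φ0 x * h x 0| ≤ Cφ * vecL2 h := by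
    obtain ⟨B, hB⟩ := (isCompact_Icc (a := (0 : ℝ)) (b := L)).exists_bound_of_continuousOn
      (hφ0.continuousOn.mono fun x hx => hx.1)
    have hχ : MemLp ((Ioc 0 L).indicator φ0) 2 (volume.restrict (Ioi (0 : ℝ))) := by
      rw [memLp_indicator_iff_restrict measurableSet_Ioc, Measure.restrict_restrict
        measurableSet_Ioc, inter_eq_self_of_subset_left Ioc_subset_Ioi_self]
      refine MemLp.of_bound ((hφ0.continuousOn.mono fun x hx => hx.1.le).aestronglyMeasurable
        measurableSet_Ioc) B ?_
      filter_upwards [ae_restrict_mem measurableSet_Ioc] with x hx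
      exact hB x ⟨hx.1.le, hx.2⟩
    refine ⟨√(∫ x in Ioi (0 : ℝ), (Ioc 0 L).indicator φ0 x ^ 2), Real.sqrt_nonneg _,
      fun h hmem hvan => ?_⟩
    have heq : ∫ x in Ioi (0 : ℝ), φ0 x * h x 0
        = ∫ x in Ioi (0 : ℝ), (Ioc 0 L).indicator φ0 x * h x 0 := by
      refine setIntegral_congr_fun measurableSet_Ioi fun x hx => ?_
      by_cases hxL : x ≤ L
      · simp only [indicator_of_mem (show x ∈ Ioc 0 L from ⟨hx, hxL⟩)]
      · simp only [hvan x (not_le.1 hxL).le, mul_zero]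
    rw [heq]
    exact hmem.abs_integral_mul_le hχ 0
  set R : ℕ → ℝ := fun n => N n + ∑ i ∈ Finset.Icc 2 (n - 1), N i * N (n + 1 - i) with hR
  have hgamle : ∀ n, 1 ≤ n →
      |gamseq n| ≤ Cφ * (3 * CB * CY + c * CY * (2 * N 1 + 1)) * R n := by
    intro n hn
    have hmemk : ∀ k ∈ Finset.Icc 1 (n + 1 - 1), 1 ≤ n + 1 - k := by
      intro k hk
      rw [Finset.mem_Icc] at hk
      omega
    have hHp : MemL2 (Hseq D1 F lamseq sseq Yp (n + 1)) :=
      memL2_Hseq hD1m hD1B hFm hFB (hYp n hn).1 fun k hk => (hYp _ (hmemk k hk)).1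
    have h1 := hCφ _ hHp fun x hx =>
      Hseq_zero_of_ge hFL hx fun k hk => (hYp _ (hmemk k hk)).2.1 x hx
    rw [← hgam n hn] at h1
    have h2 := vecL2_Hseq_le (lamseq := lamseq) (sseq := sseq) (Y := Yp) (n := n + 1)
      hD1m hD1B hFm hFB (hYp n hn).1 fun k hk => (hYp _ (hmemk k hk)).1
    simp only [Nat.add_sub_cancel] at h2 hmemk
    have h3 : ∑ k ∈ Finset.Icc 1 n, (CB * |sseq k| + |lamseq k|) * vecL2 (Yp (n + 1 - k)) ≤
        ∑ k ∈ Finset.Icc 1 n, c * CY * (N k * N (n + 1 - k)) := by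
      refine Finset.sum_le_sum fun k hk => ?_
      refine (mul_le_mul (hcoef k (Finset.mem_Icc.1 hk).1) (hYpN _ (hmemk k hk))
        (vecL2_nonneg _) (mul_nonneg hc0 (hN0 k))).trans (le_of_eq ?_)
      ring
    rw [← Finset.mul_sum] at h3
    have hnn : ∀ k, 0 ≤ N k * N (n + 1 - k) := fun k => mul_nonneg (hN0 k) (hN0 _)
    have h4 := mul_le_mul_of_nonneg_left (sum_Icc_one_le_of_pos hnn hn) (mul_nonneg hc0 hCY0)
    simp only [Nat.add_sub_cancel, Nat.add_sub_cancel_left] at h4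
    have h5 : 0 ≤ ∑ i ∈ Finset.Icc 2 (n - 1), N i * N (n + 1 - i) :=
      Finset.sum_nonneg fun k _ => hnn k
    have h6 := mul_le_mul_of_nonneg_left (hYpN n hn) (mul_nonneg zero_le_three hCB)
    refine h1.trans ?_
    rw [mul_assoc]
    refine mul_le_mul_of_nonneg_left ?_ hCφ0
    have h7 : 0 ≤ 3 * CB * CY * ∑ i ∈ Finset.Icc 2 (n - 1), N i * N (n + 1 - i) := by positivity
    have h8 : 0 ≤ c * CY * N 1 * ∑ i ∈ Finset.Icc 2 (n - 1), N i * N (n + 1 - i) :=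
      mul_nonneg (mul_nonneg (mul_nonneg hc0 hCY0) (hN0 1)) h5
    have h9 : 0 ≤ c * CY * N n := mul_nonneg (mul_nonneg hc0 hCY0) (hN0 n)
    rw [hR]
    linarith
  set Cγ : ℝ := Cφ * (3 * CB * CY + c * CY * (2 * N 1 + 1)) with hCγ
  set P : ℝ := vecL2 (fun x => ![0, C2 * φ1 x, -(C1 * φ2 x)]) with hP
  have hP0 : 0 ≤ P := vecL2_nonneg _
  refine ⟨M1, 3 * CB + c * N 1 + c, (2 + 2 * (CB + 1)) * (CY + Cγ * P + M1),
    fun n hn => ⟨ha n hn, hb n hn, ?_⟩⟩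
  have hNR : N n ≤ R n := le_add_of_nonneg_right
    (Finset.sum_nonneg fun k _ => mul_nonneg (hN0 k) (hN0 _))
  have hYn : vecL2 (Y n) ≤ (CY + Cγ * P) * R n := by
    have hYeq : Y n = fun x i => Yp n x i +
        gamseq n * (![0, C2 * φ1 x, -(C1 * φ2 x)] : Fin 3 → ℝ) i := funext (hdecomp n hn)
    have hsc : MemL2 fun x i => gamseq n * (![0, C2 * φ1 x, -(C1 * φ2 x)] : Fin 3 → ℝ) i :=
      fun i => (hperp i).const_mul _
    calc vecL2 (Y n) ≤ vecL2 (Yp n) + |gamseq n| * P := by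
          rw [hYeq]
          exact ((hYp n hn).1.vecL2_add_le hsc).trans
            (add_le_add le_rfl (hperp.vecL2_mul_le fun _ _ => le_rfl))
      _ ≤ CY * R n + Cγ * R n * P := by
          gcongr
          · exact (hYpN n hn).trans (mul_le_mul_of_nonneg_left hNR hCY0)
          · exact hgamle n hn
      _ = _ := by ring
  calc vecH2 (Y n) (Y' n)
      ≤ (2 + 2 * (CB + 1)) * (vecL2 (Y n) + vecL2 (Gseq D1 F lamseq sseq Y n)) :=
        (hYsol n hn).vecH2_le hD0m hK
          (hGmem n hn (fun m _ => hYmem m) (hHmem n hn)) (hYmem n)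
    _ ≤ (2 + 2 * (CB + 1)) * ((CY + Cγ * P) * R n + M1 * R n) := by
        gcongr
        exact (ha n hn).trans (mul_le_mul_of_nonneg_left hNR hM10)
    _ = (2 + 2 * (CB + 1)) * (CY + Cγ * P + M1) * R n := by ring

end
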